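/- arXiv:1805.02533 — 2 statements merged into one kernel-verified Lean document; each statement's English description precedes it below -/
import Mathlib

section
/- Let S be a type and let μ = (2^{#S})⁺ be the cardinal successor of 2 to the cardinality of S. For every ordinal-indexed family ⟨U_ζ : ζ < μ⟩ of ultrafilters on S there exists an ordinal ρ < μ which is a repeat point, i.e. ⋂_{ζ<ρ} U_ζ = ⋂_{ζ≤ρ} U_ζ (identifying each ultrafilter with the collection of subsets of S it contains); equivalently, every X ∈ U_ρ belongs to U_ζ for some ζ < ρ. -/
universe u

/-- No function from the ordinals below `(2 ^ #S)⁺` to the subsets of `S` is injective. -/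
theorem not_injective_of_ord_succ_two_power {S : Type u}
    (f : Set.Iio (Order.succ ((2 : Cardinal.{u}) ^ Cardinal.mk S)).ord → Set S) :
    ¬ Function.Injective f := by
  intro hf
  have h := Cardinal.mk_le_of_injective (Equiv.ulift.{u + 1, u}.symm.injective.comp hf)
  rw [Cardinal.mk_Iio_ordinal, Cardinal.card_ord, Cardinal.mk_uLift, Cardinal.mk_set,
    Cardinal.lift_le] at h
  exact (Order.lt_succ _).not_ge h

/-- For any type `S`, setting `μ = (2 ^ #S)⁺`, every ordinal-indexed
family of ultrafilters on `S` of length `μ` has a repeat point `ρ < μ`: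
`⋂_{ζ<ρ} U ζ = ⋂_{ζ≤ρ} U ζ`, equivalently every `X ∈ U ρ` belongs to some `U ζ`
with `ζ < ρ`. -/
theorem exists_repeat_point {S : Type*}
    (U : ∀ ζ : Ordinal, ζ < (Order.succ ((2 : Cardinal) ^ Cardinal.mk S)).ord → Ultrafilter S) :
    ∃ ρ, ∃ hρ : ρ < (Order.succ ((2 : Cardinal) ^ Cardinal.mk S)).ord,
      ({X : Set S | ∀ ζ (h : ζ < ρ), X ∈ U ζ (h.trans hρ)} =
        {X : Set S | ∀ ζ (h : ζ ≤ ρ), X ∈ U ζ (lt_of_le_of_lt h hρ)}) ∧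
      ∀ X : Set S, X ∈ U ρ hρ → ∃ ζ, ∃ h : ζ < ρ, X ∈ U ζ (h.trans hρ) := by
  obtain ⟨ρ, hρ, h⟩ : ∃ ρ, ∃ hρ : ρ < (Order.succ ((2 : Cardinal) ^ Cardinal.mk S)).ord,
      ∀ X : Set S, X ∈ U ρ hρ → ∃ ζ, ∃ h : ζ < ρ, X ∈ U ζ (h.trans hρ) := by
    by_contra! hU
    choose X hX hXU using hU
    refine not_injective_of_ord_succ_two_power
      (fun ρ : Set.Iio (Order.succ ((2 : Cardinal) ^ Cardinal.mk S)).ord => X ρ.1 ρ.2) ?_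
    refine Function.Injective.of_lt_imp_ne fun ζ ρ hlt heq => hXU ρ.1 ρ.2 ζ.1 hlt ?_
    have heq : X ζ.1 ζ.2 = X ρ.1 ρ.2 := heq
    exact heq ▸ hX ζ.1 ζ.2
  refine ⟨ρ, hρ, Set.ext fun X => ⟨fun hX ζ hζ => ?_, fun hX ζ hζ => hX ζ hζ.le⟩, h⟩
  obtain hlt | rfl := hζ.lt_or_eq
  · exact hX ζ hlt
  · by_contra hXρ
    obtain ⟨η, hη, hXη⟩ := h Xᶜ (Ultrafilter.compl_mem_iff_notMem.2 hXρ)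
    exact Ultrafilter.compl_mem_iff_notMem.1 hXη (hX η hη)
end

section
/- Let L be a type and let U be an ultrafilter on Set L (i.e., on the powerset of L, viewing members of U as collections of subsets of L) which is fine, meaning that for every a ∈ L the collection {x ⊆ L : a ∈ x} belongs to U, and normal, meaning that for every family ⟨A_a : a ∈ L⟩ of members of U, the diagonal intersection {x ⊆ L : for all a ∈ x, x ∈ A_a} belongs to U. Then for every permutation h : L ≃ L, the collection {x ⊆ L : h '' x = x} belongs to U. -/
/-- If `U` is a fine normal ultrafilter on the powerset of `L`
(fine: `{x | a ∈ x} ∈ U` for every `a : L`; normal: closed under diagonal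
intersections), then for every permutation `h` of `L` the collection of
`h`-fixed subsets `{x | h '' x = x}` belongs to `U`. -/
theorem fixedPoints_mem_normal_fine_ultrafilter {L : Type*} (U : Ultrafilter (Set L))
    (fine : ∀ a : L, {x : Set L | a ∈ x} ∈ U)
    (normal : ∀ A : L → Set (Set L), (∀ a : L, A a ∈ U) →
      {x : Set L | ∀ a ∈ x, x ∈ A a} ∈ U)
    (h : L ≃ L) :
    {x : Set L | (h : L → L) '' x = x} ∈ U := by
  filter_upwards [normal (fun a => {x | h a ∈ x}) fun a => fine (h a),
    normal (fun a => {x | h.symm a ∈ x}) fun a => fine (h.symm a)] with x hx hx'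
  exact (Set.image_subset_iff.2 hx).antisymm fun a ha =>
    ⟨h.symm a, hx' a ha, h.apply_symm_apply a⟩
end
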